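/- Let c be a Lipschitz cost with P(c) = 0 and let π ∈ Π(·,σ) satisfy ∫ c dπ + H(π) = 0, where c is normalized. Then π is the unique Gibbs plan for c, i.e. L̂_c^* π = π. -/

import Mathlib

open MeasureTheory Filter Topology

attribute [local instance] PiNat.dist

/-- The Bernoulli space `{1,...,d}^ℕ`, with the metric `dist z y = (1/2)^n` where `n`
is the first coordinate at which `z` and `y` differ (provided by `PiNat.dist`). -/
abbrev W (d : ℕ) : Type := ℕ → Fin d

/-- The shift map `σ` on the Bernoulli space. -/
def shift {d : ℕ} (y : W d) : W d := fun n => y (n + 1)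

/-- Prepend the symbol `a` to the sequence `y`, i.e. the point `a y` (a preimage of `y`
under the shift). -/
def cons {d : ℕ} (a : Fin d) (y : W d) : W d := fun n =>
  match n with
  | 0 => a
  | Nat.succ k => y k

variable {X : Type*} [Fintype X] [MeasurableSpace X] [TopologicalSpace X] {d : ℕ}

/-- `π ∈ Π(·,σ)`: a Borel probability on `X × Ω` whose `y`-marginal is `σ`-invariant. -/
def IsPlan (π : Measure (X × W d)) : Prop :=
  IsProbabilityMeasure π ∧
    ∀ g : W d → ℝ, Continuous g → ∫ p, g (shift p.2) ∂π = ∫ p, g p.2 ∂π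

/-- A cost `c` is normalized if `∑_{x ∈ X} ∑_{σ w = y} e^{c(x,w)} = 1` for every `y`. -/
def IsNormalized (c : X × W d → ℝ) : Prop :=
  ∀ y : W d, ∑ x : X, ∑ a : Fin d, Real.exp (c (x, cons a y)) = 1

/-- `π` is a fixed point of the dual transfer operator `L̂_c^*`, i.e. a Gibbs plan for `c`. -/
def GibbsFixed (c : X × W d → ℝ) (π : Measure (X × W d)) : Prop :=
  ∀ u : X × W d → ℝ, Continuous u →
    ∫ p, u p ∂π =
      ∫ p, ∑ x : X, ∑ a : Fin d,
        Real.exp (c (x, cons a p.2)) * u (x, cons a p.2) ∂π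

/-- `c` is a Lipschitz cost: Lipschitz in the `Ω` variable, uniformly in `x ∈ X`. -/
def LipCost (c : X × W d → ℝ) : Prop :=
  ∃ K : ℝ, ∀ (x : X) (y z : W d), |c (x, y) - c (x, z)| ≤ K * dist y z

/-- The entropy of a plan: `H(π) = inf { -∫ b dπ : b normalized }`. -/
noncomputable def Hent (π : Measure (X × W d)) : ℝ :=
  sInf {r | ∃ b : X × W d → ℝ, LipCost b ∧ IsNormalized b ∧ r = -∫ p, b p ∂π}

/-- The pressure `P(c) = sup_{π ∈ Π(·,σ)} ∫ c dπ + H(π)`. -/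
noncomputable def Pr (c : X × W d → ℝ) : ℝ :=
  sSup {r | ∃ π : Measure (X × W d), IsPlan π ∧ r = ∫ p, c p ∂π + Hent π}

set_option linter.unusedSectionVars false

/-- `v` has variation at most `R 2^{-k}` on cylinders of depth `k`. -/
def VarBd (R : ℝ) (v : W d → ℝ) : Prop :=
  ∀ (k : ℕ) (y z : W d), (∀ i < k, y i = z i) → |v y - v z| ≤ R * (1 / 2) ^ k

lemma VarBd.neg {R : ℝ} {v : W d → ℝ} (h : VarBd R v) : VarBd R (fun y => - v y) := by
  intro k y z hyz
  have := h k y z hyz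
  rwa [show - v y - - v z = -(v y - v z) by ring, abs_neg]

lemma VarBd.mono {R R' : ℝ} {v : W d → ℝ} (h : VarBd R v) (hR : R ≤ R') : VarBd R' v := by
  intro k y z hyz
  exact (h k y z hyz).trans (by gcongr)

lemma VarBd.continuous {R : ℝ} {v : W d → ℝ} (h : VarBd R v) : Continuous v := by
  rw [continuous_iff_continuousAt]
  intro y
  rw [ContinuousAt, Metric.tendsto_nhds]
  intro ε hε
  have ht : Tendsto (fun k : ℕ => R * (1 / 2 : ℝ) ^ k) atTop (𝓝 (R * 0)) :=
    (tendsto_pow_atTop_nhds_zero_of_lt_one (by norm_num) (by norm_num)).const_mul R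
  rw [mul_zero] at ht
  obtain ⟨k, hk⟩ := (ht.eventually (gt_mem_nhds hε)).exists
  have ho : IsOpen {z : W d | ∀ i < k, z i = y i} := by
    have : {z : W d | ∀ i < k, z i = y i} = ⋂ i ∈ Set.Iio k, {z : W d | z i = y i} := by
      ext z; simp
    rw [this]
    apply (Set.finite_Iio k).isOpen_biInter
    intro i _
    have hci : Continuous (fun z : W d => z i) := continuous_apply i
    exact (isOpen_discrete ({y i} : Set (Fin d))).preimage hci
  filter_upwards [ho.mem_nhds (by simp : y ∈ {z : W d | ∀ i < k, z i = y i})] with z hz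
  rw [Real.dist_eq]
  exact (h k z y hz).trans_lt hk

lemma cons_agree {k : ℕ} {y z : W d} (a : Fin d) (h : ∀ i < k, y i = z i) :
    ∀ i < k + 1, cons a y i = cons a z i := by
  intro i hi
  cases i with
  | zero => rfl
  | succ j => exact h j (by omega)

lemma cons_shift (y : W d) : cons (y 0) (shift y) = y := by
  funext i
  cases i <;> rfl

lemma continuous_cons (a : Fin d) : Continuous (cons a : W d → W d) := by
  apply continuous_pi
  intro i
  cases i with
  | zero => exact continuous_const
  | succ j => exact continuous_apply j

/-- transfer operator acting on functions of `y`. -/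
noncomputable def Lop (E : X × W d → ℝ) (v : W d → ℝ) (y : W d) : ℝ :=
  ∑ x : X, ∑ a : Fin d, E (x, cons a y) * v (cons a y)


lemma Lop_neg (E : X × W d → ℝ) (v : W d → ℝ) :
    Lop E (fun y => - v y) = fun y => - Lop E v y := by
  funext y
  simp [Lop]

lemma Lop_iter_neg (E : X × W d → ℝ) (N : ℕ) (v : W d → ℝ) :
    (Lop E)^[N] (fun y => - v y) = fun y => - (Lop E)^[N] v y := by
  induction N generalizing v with
  | zero => rfl
  | succ n ih => rw [Function.iterate_succ_apply, Lop_neg, ih, Function.iterate_succ_apply]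

lemma Lop_le {E : X × W d → ℝ} (hpos : ∀ p, 0 ≤ E p)
    (hsum : ∀ y, ∑ x : X, ∑ a : Fin d, E (x, cons a y) = 1)
    {v : W d → ℝ} {M : ℝ} (hv : ∀ y, v y ≤ M) (y : W d) : Lop E v y ≤ M := by
  calc Lop E v y ≤ ∑ x : X, ∑ a : Fin d, E (x, cons a y) * M := by
        unfold Lop
        gcongr with x _ a _
        · exact hpos _
        · exact hv _
    _ = M := by simp_rw [← Finset.sum_mul]; rw [hsum, one_mul]

lemma Lop_abs {E : X × W d → ℝ} (hpos : ∀ p, 0 ≤ E p)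
    (hsum : ∀ y, ∑ x : X, ∑ a : Fin d, E (x, cons a y) = 1)
    {v : W d → ℝ} {M : ℝ} (hv : ∀ y, |v y| ≤ M) (y : W d) : |Lop E v y| ≤ M := by
  rw [abs_le]
  constructor
  · have := Lop_le hpos hsum (v := fun y => - v y) (M := M)
      (fun y => by linarith [(abs_le.1 (hv y)).1]) y
    rw [Lop_neg] at this
    linarith
  · exact Lop_le hpos hsum (fun y => (abs_le.1 (hv y)).2) y

lemma Lop_iter_le [Nonempty X] {E : X × W d → ℝ} {δ : ℝ} (hδ : 0 < δ) (hE : ∀ p, δ ≤ E p)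
    (hsum : ∀ y, ∑ x : X, ∑ a : Fin d, E (x, cons a y) = 1) (N : ℕ) {M s : ℝ} (hs : s ≤ M)
    {v : W d → ℝ} (hv : ∀ y, v y ≤ M) (z : W d)
    (hz : ∀ y, (∀ i < N, y i = z i) → v y ≤ s) (y : W d) :
    (Lop E)^[N] v y ≤ M - δ ^ N * (M - s) := by
  have hpos : ∀ p, 0 ≤ E p := fun p => hδ.le.trans (hE p)
  induction N generalizing v s z with
  | zero => simpa using hz y (by simp)
  | succ n ih =>
    rw [Function.iterate_succ_apply]
    have hδ1 : δ * (M - s) ≥ 0 := mul_nonneg hδ.le (by linarith)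
    have := ih (s := M - δ * (M - s)) (by linarith) (v := Lop E v) (Lop_le hpos hsum hv)
      (shift z) ?_
    · rw [pow_succ]; linarith
    · intro y hy
      obtain ⟨x0⟩ := ‹Nonempty X›
      have h1 : v (cons (z 0) y) ≤ s := by
        apply hz
        have := cons_agree (z 0) hy
        rwa [cons_shift] at this
      have h2 : δ * (M - s) ≤ ∑ x : X, ∑ a : Fin d, E (x, cons a y) * (M - v (cons a y)) := by
        have hnn : ∀ x a, 0 ≤ E (x, cons a y) * (M - v (cons a y)) := fun x a =>
          mul_nonneg (hpos _) (by linarith [hv (cons a y)])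
        calc δ * (M - s) ≤ E (x0, cons (z 0) y) * (M - v (cons (z 0) y)) :=
              mul_le_mul (hE _) (by linarith) (by linarith) (hpos _)
          _ ≤ ∑ a : Fin d, E (x0, cons a y) * (M - v (cons a y)) :=
              Finset.single_le_sum (f := fun a => E (x0, cons a y) * (M - v (cons a y)))
                (fun a _ => hnn x0 a) (Finset.mem_univ _)
          _ ≤ _ := Finset.single_le_sum
                (f := fun x => ∑ a : Fin d, E (x, cons a y) * (M - v (cons a y)))
                (fun x _ => Finset.sum_nonneg fun a _ => hnn x a) (Finset.mem_univ _)
      have h3 : ∑ x : X, ∑ a : Fin d, E (x, cons a y) * (M - v (cons a y)) = M - Lop E v y := by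
        simp only [mul_sub, Finset.sum_sub_distrib, ← Finset.sum_mul]
        rw [hsum, one_mul]; rfl
      linarith

lemma Lop_var_aux {E : X × W d → ℝ} {K : ℝ} (hpos : ∀ p, 0 ≤ E p)
    (hsum : ∀ y, ∑ x : X, ∑ a : Fin d, E (x, cons a y) = 1)
    (hvar : ∀ x, VarBd K (fun y => E (x, y))) (hK : 0 ≤ K)
    {u : X × W d → ℝ} {B R : ℝ} (hB : ∀ p, |u p| ≤ B) (hR : ∀ x, VarBd R (fun y => u (x, y)))
    (hRB : Fintype.card X * d * (K * B) ≤ R) :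
    VarBd R (fun y => ∑ x : X, ∑ a : Fin d, E (x, cons a y) * u (x, cons a y)) := by
  intro k y z hyz
  have hb : ∀ x a, |E (x, cons a y) * u (x, cons a y) - E (x, cons a z) * u (x, cons a z)|
      ≤ E (x, cons a y) * (R * (1 / 2) ^ (k + 1)) + K * (1 / 2) ^ (k + 1) * B := by
    intro x a
    have h1 := hvar x (k + 1) _ _ (cons_agree a hyz)
    have h2 := hR x (k + 1) _ _ (cons_agree a hyz)
    have h3 := hB (x, cons a z)
    rw [show E (x, cons a y) * u (x, cons a y) - E (x, cons a z) * u (x, cons a z)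
      = E (x, cons a y) * (u (x, cons a y) - u (x, cons a z))
        + (E (x, cons a y) - E (x, cons a z)) * u (x, cons a z) by ring]
    refine (abs_add_le _ _).trans ?_
    rw [abs_mul, abs_mul, abs_of_nonneg (hpos _)]
    have h0 := hpos (x, cons a y)
    gcongr
  dsimp only
  rw [← Finset.sum_sub_distrib]
  simp_rw [← Finset.sum_sub_distrib]
  calc _ ≤ ∑ x : X, ∑ a : Fin d,
      (E (x, cons a y) * (R * (1 / 2) ^ (k + 1)) + K * (1 / 2) ^ (k + 1) * B) := by
        refine (Finset.abs_sum_le_sum_abs _ _).trans ?_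
        gcongr with x _
        refine (Finset.abs_sum_le_sum_abs _ _).trans ?_
        gcongr with a _
        exact hb x a
    _ = R * (1 / 2) ^ (k + 1) + Fintype.card X * d * (K * B) * (1 / 2) ^ (k + 1) := by
        simp only [Finset.sum_add_distrib, ← Finset.sum_mul]
        rw [hsum]
        simp
        ring
    _ ≤ R * (1 / 2) ^ (k + 1) + R * (1 / 2) ^ (k + 1) := by gcongr
    _ = R * (1 / 2) ^ k := by rw [pow_succ]; ring


lemma unique_marg [Nonempty X] {E : X × W d → ℝ} {δ K : ℝ} (hδ : 0 < δ) (hE : ∀ p, δ ≤ E p)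
    (hsum : ∀ y, ∑ x : X, ∑ a : Fin d, E (x, cons a y) = 1)
    (hvar : ∀ x, VarBd K (fun y => E (x, y))) (hK : 0 ≤ K)
    (μ ν : Measure (X × W d)) [IsProbabilityMeasure μ] [IsProbabilityMeasure ν]
    (hμ : ∀ v : W d → ℝ, Continuous v → ∫ p, v p.2 ∂μ = ∫ p, Lop E v p.2 ∂μ)
    (hν : ∀ v : W d → ℝ, Continuous v → ∫ p, v p.2 ∂ν = ∫ p, Lop E v p.2 ∂ν)
    (v : W d → ℝ) (B R : ℝ) (hB : ∀ y, |v y| ≤ B) (hR : VarBd R v) :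
    ∫ p, v p.2 ∂μ = ∫ p, v p.2 ∂ν := by
  have hpos : ∀ p, 0 ≤ E p := fun p => hδ.le.trans (hE p)
  wlog hRB : Fintype.card X * d * (K * B) ≤ R generalizing R
  · exact this (max R (Fintype.card X * d * (K * B))) (hR.mono (le_max_left _ _))
      (le_max_right _ _)
  obtain ⟨p0⟩ : Nonempty (X × W d) := nonempty_of_isProbabilityMeasure μ
  have hδ1 : δ ≤ 1 := by
    rw [← hsum p0.2]
    calc δ ≤ E (p0.1, cons (p0.2 0) p0.2) := hE _
      _ ≤ ∑ a : Fin d, E (p0.1, cons a p0.2) :=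
          Finset.single_le_sum (f := fun a => E (p0.1, cons a p0.2))
            (fun a _ => hpos _) (Finset.mem_univ _)
      _ ≤ _ := Finset.single_le_sum (f := fun x => ∑ a : Fin d, E (x, cons a p0.2))
            (fun x _ => Finset.sum_nonneg fun a _ => hpos _) (Finset.mem_univ _)
  -- the invariant class
  have hcls : ∀ N, ∀ v : W d → ℝ, (∀ y, |v y| ≤ B) → VarBd R v →
      (∀ y, |(Lop E)^[N] v y| ≤ B) ∧ VarBd R ((Lop E)^[N] v) ∧
      ∫ p, v p.2 ∂μ = ∫ p, (Lop E)^[N] v p.2 ∂μ ∧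
      ∫ p, v p.2 ∂ν = ∫ p, (Lop E)^[N] v p.2 ∂ν := by
    intro N
    induction N with
    | zero => intro v h1 h2; exact ⟨h1, h2, rfl, rfl⟩
    | succ n ih =>
      intro v h1 h2
      obtain ⟨a1, a2, a3, a4⟩ := ih (Lop E v) (Lop_abs hpos hsum h1)
        (Lop_var_aux hpos hsum hvar hK (u := fun p => v p.2) (fun p => h1 p.2) (fun _ => h2) hRB)
      simp only [Function.iterate_succ_apply]
      exact ⟨a1, a2, (hμ v h2.continuous).trans a3, (hν v h2.continuous).trans a4⟩
  have hint : ∀ (ρ : Measure (X × W d)) [IsProbabilityMeasure ρ] (v : W d → ℝ) (m M : ℝ),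
      Continuous v → (∀ y, m ≤ v y) → (∀ y, v y ≤ M) →
      m ≤ ∫ p, v p.2 ∂ρ ∧ ∫ p, v p.2 ∂ρ ≤ M := by
    intro ρ _ v m M hv h1 h2
    have hi : Integrable (fun p : X × W d => v p.2) ρ := by
      refine Integrable.of_bound (C := max |m| |M|)
        (hv.measurable.comp measurable_snd).aestronglyMeasurable (Eventually.of_forall ?_)
      intro p
      rw [Real.norm_eq_abs]
      exact abs_le_max_abs_abs (h1 _) (h2 _)
    constructor
    · simpa using integral_mono (integrable_const m) hi (fun p => h1 p.2)
    · simpa using integral_mono hi (integrable_const M) (fun p => h2 p.2)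
  have key : ∀ ε > 0, |∫ p, v p.2 ∂μ - ∫ p, v p.2 ∂ν| ≤ 2 * ε := by
    intro ε hε
    have ht : Tendsto (fun k : ℕ => R * (1 / 2 : ℝ) ^ k) atTop (𝓝 (R * 0)) :=
      (tendsto_pow_atTop_nhds_zero_of_lt_one (by norm_num) (by norm_num)).const_mul R
    rw [mul_zero] at ht
    obtain ⟨N, hN⟩ := (ht.eventually (gt_mem_nhds hε)).exists
    have hq0 : 0 < δ ^ N := pow_pos hδ N
    have hq1 : δ ^ N ≤ 1 := pow_le_one₀ hδ.le hδ1
    have half : ∀ v : W d → ℝ, VarBd R v → ∀ M, (∀ y, v y ≤ M) → ∀ y,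
        (Lop E)^[N] v y ≤ M - δ ^ N * (M - (v p0.2 + ε)) := by
      intro v h2 M hM y
      have h3 : ∀ y, (∀ i < N, y i = p0.2 i) → v y ≤ v p0.2 + ε := by
        intro y hy
        have := (abs_le.1 (h2 N y p0.2 hy)).2
        linarith
      have := Lop_iter_le hδ hE hsum N (min_le_left M (v p0.2 + ε)) hM p0.2
        (fun y hy => le_min (hM y) (h3 y hy)) y
      have h4 : δ ^ N * (M - (v p0.2 + ε)) ≤ δ ^ N * (M - min M (v p0.2 + ε)) := by
        gcongr
        exact min_le_right _ _
      linarith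
    have ind : ∀ j : ℕ, ∀ v : W d → ℝ, (∀ y, |v y| ≤ B) → VarBd R v → ∀ m M,
        (∀ y, m ≤ v y) → (∀ y, v y ≤ M) →
        |∫ p, v p.2 ∂μ - ∫ p, v p.2 ∂ν| ≤ (1 - δ ^ N) ^ j * (M - m - 2 * ε) + 2 * ε := by
      intro j
      induction j with
      | zero =>
        intro v h1 h2 m M hm hM
        have b1 := hint μ v m M h2.continuous hm hM
        have b2 := hint ν v m M h2.continuous hm hM
        rw [abs_le]
        constructor <;> simp <;> linarith
      | succ j ih =>
        intro v h1 h2 m M hm hM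
        obtain ⟨a1, a2, a3, a4⟩ := hcls N v h1 h2
        have u1 := half v h2 M hM
        have u2 : ∀ y, m + δ ^ N * (v p0.2 - ε - m) ≤ (Lop E)^[N] v y := by
          intro y
          have := half _ h2.neg (-m) (fun y => by linarith [hm y]) y
          rw [Lop_iter_neg] at this
          linarith
        rw [a3, a4]
        refine (ih _ a1 a2 _ _ u2 u1).trans (le_of_eq ?_)
        ring
    have hl : Tendsto (fun j : ℕ => (1 - δ ^ N) ^ j * (B - (-B) - 2 * ε) + 2 * ε) atTop
        (𝓝 (0 * (B - (-B) - 2 * ε) + 2 * ε)) :=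
      ((tendsto_pow_atTop_nhds_zero_of_lt_one (by linarith) (by linarith)).mul_const _).add_const _
    rw [zero_mul, zero_add] at hl
    exact ge_of_tendsto' hl fun j => ind j v hB hR (-B) B
      (fun y => (abs_le.1 (hB y)).1) (fun y => (abs_le.1 (hB y)).2)
  by_contra hne
  have hp : 0 < |∫ p, v p.2 ∂μ - ∫ p, v p.2 ∂ν| := abs_pos.2 (sub_ne_zero.2 hne)
  have := key (|∫ p, v p.2 ∂μ - ∫ p, v p.2 ∂ν| / 4) (by linarith)
  linarith

lemma ext_rect (μ ν : Measure (X × W d)) [IsFiniteMeasure μ]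
    (h : ∀ A : Set X, MeasurableSet A → ∀ C ∈ measurableCylinders (fun _ : ℕ => Fin d),
      μ (A ×ˢ C) = ν (A ×ˢ C)) : μ = ν := by
  have huniv : Set.univ ∈ measurableCylinders (fun _ : ℕ => Fin d) := univ_mem_measurableCylinders _
  refine ext_of_generate_finite
    (Set.image2 (· ×ˢ ·) {A : Set X | MeasurableSet A} (measurableCylinders (fun _ : ℕ => Fin d)))
    ?_ ?_ ?_ ?_
  · refine (generateFrom_eq_prod (@MeasurableSpace.generateFrom_measurableSet X _)
      generateFrom_measurableCylinders ?_ ?_).symm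
    · exact isCountablySpanning_measurableSet
    · exact ⟨fun _ => Set.univ, fun _ => huniv, Set.iUnion_const _⟩
  · exact MeasurableSpace.isPiSystem_measurableSet.prod isPiSystem_measurableCylinders
  · rintro _ ⟨A, hA, C, hC, rfl⟩
    exact h A hA C hC
  · rw [← Set.univ_prod_univ]
    exact h _ MeasurableSet.univ _ huniv

lemma cyl_var {C : Set (W d)} (hC : C ∈ measurableCylinders (fun _ : ℕ => Fin d)) :
    ∃ R, VarBd R (C.indicator (fun _ => (1 : ℝ))) := by
  obtain ⟨s, S, -, rfl⟩ := (mem_measurableCylinders _).1 hC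
  refine ⟨2 ^ (s.sup id + 1), ?_⟩
  intro k y z hyz
  by_cases hk : s.sup id + 1 ≤ k
  · have : s.restrict y = s.restrict z := by
      funext i
      apply hyz
      have : id i.1 ≤ s.sup id := Finset.le_sup i.2
      simp only [id] at this
      omega
    have h2 : (cylinder s S).indicator (fun _ => (1 : ℝ)) y =
        (cylinder s S).indicator (fun _ => (1 : ℝ)) z := by
      by_cases hz : s.restrict z ∈ S
      · rw [Set.indicator_of_mem, Set.indicator_of_mem] <;> simpa [mem_cylinder, this] using hz
      · rw [Set.indicator_of_notMem, Set.indicator_of_notMem] <;>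
          simpa [mem_cylinder, this] using hz
    rw [h2, sub_self, abs_zero]
    positivity
  · have h1 : |(cylinder s S).indicator (fun _ => (1 : ℝ)) y -
        (cylinder s S).indicator (fun _ => (1 : ℝ)) z| ≤ 1 := by
      simp only [Set.indicator]
      split_ifs <;> simp
    refine h1.trans ?_
    rw [one_div, inv_pow, ← div_eq_mul_inv, one_le_div (by positivity)]
    exact pow_le_pow_right₀ (by norm_num) (by omega)

lemma atom_const {J : X × W d → ℝ} (hJ : Measurable J) {x x' : X} (h : x' ∈ measurableAtom x)
    (y : W d) : J (x', y) = J (x, y) := by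
  have hm : MeasurableSet {z : X | J (z, y) = J (x, y)} :=
    (hJ.comp measurable_prodMk_right) (measurableSet_singleton (J (x, y)))
  exact mem_of_mem_measurableAtom h hm rfl

lemma measurable_cons (a : Fin d) : Measurable (cons a : W d → W d) :=
  (continuous_cons a).measurable

lemma measurable_branch (x : X) (a : Fin d) :
    Measurable (fun p : X × W d => ((x, cons a p.2) : X × W d)) :=
  measurable_const.prodMk ((measurable_cons a).comp measurable_snd)

/-- The measure `∫ ∑ f δ_{(x, a y)}`. -/
noncomputable def Mm (pl : Measure (X × W d)) (f : X × W d → ENNReal) : Measure (X × W d) :=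
  ∑ x : X, ∑ a : Fin d, (pl.withDensity (fun p => f (x, cons a p.2))).map
    (fun p => (x, cons a p.2))

lemma lintegral_Mm (pl : Measure (X × W d)) {f G : X × W d → ENNReal} (hf : Measurable f)
    (hG : Measurable G) : ∫⁻ p, G p ∂(Mm pl f) =
      ∫⁻ p, ∑ x : X, ∑ a : Fin d, f (x, cons a p.2) * G (x, cons a p.2) ∂pl := by
  have hfb := fun x a => hf.comp (measurable_branch (d := d) (X := X) x a)
  have hGb := fun x a => hG.comp (measurable_branch (d := d) (X := X) x a)
  simp only [Function.comp_def] at hfb hGb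
  have hfG : ∀ x a, Measurable
      (fun p : X × W d => f (x, cons a p.2) * G (x, cons a p.2)) := fun x a =>
    (hfb x a).mul (hGb x a)
  rw [lintegral_finsetSum _ (fun x _ => Finset.measurable_fun_sum _ fun a _ => hfG x a)]
  unfold Mm
  rw [lintegral_finsetSum_measure]
  refine Finset.sum_congr rfl fun x _ => ?_
  rw [lintegral_finsetSum _ (fun a _ => hfG x a), lintegral_finsetSum_measure]
  refine Finset.sum_congr rfl fun a _ => ?_
  rw [lintegral_map hG (measurable_branch x a), lintegral_withDensity_eq_lintegral_mul _ (hfb x a)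
    (hGb x a)]
  rfl

lemma Mm_apply (pl : Measure (X × W d)) {f : X × W d → ENNReal} (hf : Measurable f)
    {S : Set (X × W d)} (hS : MeasurableSet S) : Mm pl f S =
      ∫⁻ p, ∑ x : X, ∑ a : Fin d, f (x, cons a p.2) * S.indicator 1 (x, cons a p.2) ∂pl := by
  rw [← lintegral_Mm pl hf (measurable_one.indicator hS), lintegral_indicator_one hS]

lemma Mm_real (pl : Measure (X × W d)) {φ : X × W d → ℝ} (hφ : Measurable φ)
    (h0 : ∀ p, 0 ≤ φ p) {S : Set (X × W d)} (hS : MeasurableSet S) :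
    (Mm pl (fun p => ENNReal.ofReal (φ p)) S).toReal =
      ∫ p, ∑ x : X, ∑ a : Fin d,
        φ (x, cons a p.2) * S.indicator (fun _ => (1 : ℝ)) (x, cons a p.2) ∂pl := by
  have hi : ∀ p, 0 ≤ S.indicator (fun _ => (1 : ℝ)) p := fun p =>
    Set.indicator_nonneg (fun _ _ => zero_le_one) p
  have hm : Measurable (fun p => φ p * S.indicator (fun _ => (1 : ℝ)) p) :=
    hφ.mul (measurable_const.indicator hS)
  rw [integral_eq_lintegral_of_nonneg_ae, Mm_apply pl hφ.ennreal_ofReal hS]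
  · congr 1
    apply lintegral_congr
    intro p
    rw [ENNReal.ofReal_sum_of_nonneg
      (fun x _ => Finset.sum_nonneg fun a _ => mul_nonneg (h0 _) (hi _))]
    refine Finset.sum_congr rfl fun x _ => ?_
    rw [ENNReal.ofReal_sum_of_nonneg (fun a _ => mul_nonneg (h0 _) (hi _))]
    refine Finset.sum_congr rfl fun a _ => ?_
    rw [ENNReal.ofReal_mul (h0 _)]
    congr 1
    by_cases h : ((x, cons a p.2) : X × W d) ∈ S <;> simp [h]
  · exact Eventually.of_forall fun p =>
      Finset.sum_nonneg fun x _ => Finset.sum_nonneg fun a _ => mul_nonneg (h0 _) (hi _)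
  · exact (Finset.measurable_fun_sum _ fun x _ => Finset.measurable_fun_sum _ fun a _ =>
      hm.comp (measurable_branch x a)).aestronglyMeasurable

lemma branch_integrable [DiscreteTopology X]
    (pl : Measure (X × W d)) [IsProbabilityMeasure pl]
    (J : X × W d → ℝ) (hJmeas : Measurable J)
    (hJsum : ∀ᵐ p ∂pl, ∑ x : X, ∑ a : Fin d, J (x, cons a p.2) = 1)
    (hCoV : ∀ w : X × W d → ℝ, Continuous w →
      ∫ p, ∑ x : X, ∑ a : Fin d,
          J (x, cons a p.2) * w (x, cons a p.2) ∂pl = ∫ p, w p ∂pl) (x : X) (a : Fin d) :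
    Integrable (fun p => J (x, cons a p.2)) pl := by
  classical
  by_contra hni
  set A := measurableAtom x with hA
  have hAm : MeasurableSet A := MeasurableSet.measurableAtom_of_countable x
  let w0 : X × W d → ℝ := fun p => A.indicator (fun _ => (1 : ℝ)) p.1 * if p.2 0 = a then 1 else 0
  have hite : Continuous (fun y : W d => if y 0 = a then (1 : ℝ) else 0) :=
    (continuous_of_discreteTopology (f := fun b : Fin d => if b = a then (1 : ℝ) else 0)).comp
      (continuous_apply (A := fun _ : ℕ => Fin d) 0)
  have hw0c : Continuous w0 := by
    rw [continuous_prod_of_discrete_left]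
    intro z
    exact continuous_const_mul (A.indicator (fun _ => (1 : ℝ)) z) |>.comp hite
  have hw0m : Measurable w0 :=
    ((measurable_const.indicator hAm).comp measurable_fst).mul
      (hite.measurable.comp measurable_snd)
  have hw0i : Integrable w0 pl := by
    refine Integrable.of_bound (C := 1) hw0m.aestronglyMeasurable (Eventually.of_forall ?_)
    intro p
    simp only [w0, Set.indicator]
    split_ifs <;> simp
  set n : ℝ := ∑ z : X, A.indicator (fun _ => (1 : ℝ)) z with hn
  have hnpos : 0 < n := by
    refine Finset.sum_pos' (fun z _ => Set.indicator_nonneg (fun _ _ => zero_le_one) z)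
      ⟨x, Finset.mem_univ _, ?_⟩
    rw [Set.indicator_of_mem (mem_measurableAtom_self x)]
    norm_num
  have hzero : ∀ t : ℝ, ∫ p, w0 p ∂pl + t = 0 := by
    intro t
    have h1 := hCoV (fun p => w0 p + t) (hw0c.add continuous_const)
    rw [integral_add hw0i (integrable_const t)] at h1
    simp only [integral_const, probReal_univ, smul_eq_mul, one_mul] at h1
    rw [← h1]
    apply integral_undef
    intro hint
    apply hni
    have hae : (fun p : X × W d => ∑ z : X, ∑ b : Fin d,
        J (z, cons b p.2) * (w0 (z, cons b p.2) + t)) =ᵐ[pl]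
        fun p => n * J (x, cons a p.2) + t := by
      filter_upwards [hJsum] with p hp
      simp only [mul_add, Finset.sum_add_distrib, ← Finset.sum_mul]
      rw [hp, one_mul, hn, Finset.sum_mul]
      congr 1
      refine Finset.sum_congr rfl fun z _ => ?_
      have : ∀ b : Fin d, cons b p.2 0 = b := fun b => rfl
      simp only [w0, this]
      rw [Finset.sum_eq_single a]
      · by_cases hz : z ∈ A
        · simp [hz, atom_const hJmeas hz]
        · simp [hz]
      · intro b _ hb; simp [hb]
      · simp
    have h2 := ((hint.congr hae).sub (integrable_const t)).const_mul n⁻¹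
    refine h2.congr (Eventually.of_forall fun p => ?_)
    simp only [Pi.sub_apply]
    field_simp
    ring
  have a0 := hzero 0
  have a1 := hzero 1
  linarith

lemma rect_continuous [DiscreteTopology X] (A : Set X) {C : Set (W d)}
    (hC : C ∈ measurableCylinders (fun _ : ℕ => Fin d)) :
    Continuous ((A ×ˢ C).indicator (fun _ => (1 : ℝ))) := by
  obtain ⟨R, hR⟩ := cyl_var hC
  rw [continuous_prod_of_discrete_left]
  intro z
  by_cases hz : z ∈ A
  · convert hR.continuous using 1
    funext y
    by_cases hy : y ∈ C <;> simp [hz, hy]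
  · convert (continuous_const : Continuous fun _ : W d => (0 : ℝ)) using 1
    funext y
    simp [hz]

lemma branch_measure [DiscreteTopology X]
    (pl : Measure (X × W d)) [IsProbabilityMeasure pl]
    (J : X × W d → ℝ) (hJmeas : Measurable J)
    (hJpos : ∀ᵐ p ∂pl, 0 < J p)
    (hJi : ∀ x a, Integrable (fun p => J (x, cons a p.2)) pl)
    (hCoV : ∀ w : X × W d → ℝ, Continuous w →
      ∫ p, ∑ x : X, ∑ a : Fin d,
          J (x, cons a p.2) * w (x, cons a p.2) ∂pl = ∫ p, w p ∂pl) :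
    (∀ᵐ p ∂pl, ∀ x a, 0 ≤ J (x, cons a p.2)) ∧
      pl = Mm pl (fun p => ENNReal.ofReal (J p)) := by
  have hJn : Measurable (fun p => max (-J p) 0) := hJmeas.neg.max measurable_const
  have hJp : Measurable (fun p => max (J p) 0) := hJmeas.max measurable_const
  have e1 : (fun p => ENNReal.ofReal (J p)) = fun p => ENNReal.ofReal (max (J p) 0) := by
    funext p; rw [ENNReal.ofReal_max]; simp
  set fp : X × W d → ENNReal := fun p => ENNReal.ofReal (max (J p) 0) with hfp
  set fn : X × W d → ENNReal := fun p => ENNReal.ofReal (max (-J p) 0) with hfn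
  rw [e1]
  have hfin : ∀ φ : X × W d → ℝ, Measurable φ →
      (∀ x a, Integrable (fun p => φ (x, cons a p.2)) pl) →
      Mm pl (fun p => ENNReal.ofReal (φ p)) Set.univ < ⊤ := by
    intro φ hφ hi
    rw [Mm_apply pl hφ.ennreal_ofReal MeasurableSet.univ]
    simp only [Set.indicator_univ, Pi.one_apply, mul_one]
    have hm : ∀ x a, Measurable (fun p : X × W d => ENNReal.ofReal (φ (x, cons a p.2))) :=
      fun x a => (hφ.comp (measurable_branch x a)).ennreal_ofReal
    rw [lintegral_finsetSum _ (fun x _ => Finset.measurable_fun_sum _ fun a _ => hm x a)]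
    refine ENNReal.sum_lt_top.2 fun x _ => ?_
    rw [lintegral_finsetSum _ (fun a _ => hm x a)]
    refine ENNReal.sum_lt_top.2 fun a _ => ?_
    exact (hi x a).lintegral_lt_top
  have hJni : ∀ x a, Integrable (fun p : X × W d => max (-J (x, cons a p.2)) 0) pl :=
    fun x a => (hJi x a).neg_part
  have hJpi : ∀ x a, Integrable (fun p : X × W d => max (J (x, cons a p.2)) 0) pl :=
    fun x a => (hJi x a).pos_part
  have hnf := hfin _ hJn hJni
  have hpf := hfin _ hJp hJpi
  have : IsFiniteMeasure (Mm pl fn) := ⟨hnf⟩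
  have : IsFiniteMeasure (Mm pl fp) := ⟨hpf⟩
  have hadd : pl + Mm pl fn = Mm pl fp := by
    apply ext_rect
    intro A hA C hC
    have hS : MeasurableSet (A ×ˢ C) := hA.prod (MeasurableSet.of_mem_measurableCylinders hC)
    set S := A ×ˢ C with hSdef
    have hmulInd : ∀ φ : X × W d → ℝ, (∀ x a, Integrable (fun p => φ (x, cons a p.2)) pl) →
        Integrable (fun p => ∑ x : X, ∑ a : Fin d,
          φ (x, cons a p.2) * S.indicator (fun _ => (1 : ℝ)) (x, cons a p.2)) pl := by
      intro φ hi
      refine integrable_finsetSum _ fun x _ => integrable_finsetSum _ fun a _ => ?_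
      refine ((hi x a).indicator ((measurable_branch x a) hS)).congr
        (Eventually.of_forall fun p => ?_)
      by_cases h : ((x, cons a p.2) : X × W d) ∈ S <;> simp [Set.indicator, h]
    have h1 := hCoV _ (rect_continuous A hC)
    rw [← hSdef, integral_indicator hS] at h1
    simp only [integral_const, smul_eq_mul, mul_one] at h1
    have h2 := Mm_real pl hJn (fun p => le_max_right _ _) hS
    have h3 := Mm_real pl hJp (fun p => le_max_right _ _) hS
    have h4 : ∫ p, ∑ x : X, ∑ a : Fin d, max (J (x, cons a p.2)) 0 *
        S.indicator (fun _ => (1 : ℝ)) (x, cons a p.2) ∂pl =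
        (∫ p, ∑ x : X, ∑ a : Fin d, J (x, cons a p.2) *
          S.indicator (fun _ => (1 : ℝ)) (x, cons a p.2) ∂pl) +
        ∫ p, ∑ x : X, ∑ a : Fin d, max (-J (x, cons a p.2)) 0 *
          S.indicator (fun _ => (1 : ℝ)) (x, cons a p.2) ∂pl := by
      rw [← integral_add (hmulInd _ hJi) (hmulInd (fun p => max (-J p) 0) hJni)]
      congr 1
      funext p
      simp only [← Finset.sum_add_distrib, ← add_mul]
      refine Finset.sum_congr rfl fun x _ => Finset.sum_congr rfl fun a _ => ?_
      congr 1
      rcases le_total 0 (J (x, cons a p.2)) with h | h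
      · rw [max_eq_left h, max_eq_right (by linarith)]; ring
      · rw [max_eq_right h, max_eq_left (by linarith)]; ring
    rw [← h2, ← h3, h1] at h4
    rw [Measure.add_apply, ← ENNReal.toReal_eq_toReal_iff' (by finiteness) (by finiteness),
      ENNReal.toReal_add (by finiteness) (by finiteness), h4]
    congr 1
    simp [Measure.real]
  have hnn : ∀ᵐ p ∂pl, ∀ x a, 0 ≤ J (x, cons a p.2) := by
    have hE : MeasurableSet {p | J p ≤ 0} := measurableSet_le hJmeas measurable_const
    have h0 : pl {p | J p ≤ 0} = 0 := by
      have := ae_iff.1 hJpos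
      simpa only [not_lt] using this
    have h1 : Mm pl fp {p | J p ≤ 0} = 0 := by
      rw [Mm_apply pl hJp.ennreal_ofReal hE]
      rw [lintegral_eq_zero_of_ae_eq_zero]
      refine Eventually.of_forall fun p => ?_
      refine Finset.sum_eq_zero fun x _ => Finset.sum_eq_zero fun a _ => ?_
      by_cases h : J (x, cons a p.2) ≤ 0
      · rw [max_eq_right h]; simp
      · rw [Set.indicator_of_notMem (by exact h)]; simp
    have h2 : Mm pl fn {p | J p ≤ 0} = 0 := by
      rw [← hadd, Measure.add_apply, h0, zero_add] at h1
      exact h1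
    rw [Mm_apply pl hJn.ennreal_ofReal hE, lintegral_eq_zero_iff] at h2
    · filter_upwards [h2] with p hp x a
      simp only [Pi.zero_apply, Finset.sum_eq_zero_iff, Finset.mem_univ, true_imp_iff] at hp
      have := hp x a
      by_contra hneg
      push Not at hneg
      rw [Set.indicator_of_mem (by exact hneg.le), max_eq_left (by linarith)] at this
      simp at this
      linarith
    · exact Finset.measurable_fun_sum _ fun x _ => Finset.measurable_fun_sum _ fun a _ =>
        (hJn.ennreal_ofReal.mul (measurable_one.indicator hE)).comp (measurable_branch x a)
  refine ⟨hnn, ?_⟩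
  have hz : Mm pl fn = 0 := by
    ext S hS
    rw [Mm_apply pl hJn.ennreal_ofReal hS]
    simp only [Measure.coe_zero, Pi.zero_apply]
    rw [lintegral_eq_zero_of_ae_eq_zero]
    filter_upwards [hnn] with p hp
    refine Finset.sum_eq_zero fun x _ => Finset.sum_eq_zero fun a _ => ?_
    rw [max_eq_right (by linarith [hp x a])]
    simp
  rw [hz, add_zero] at hadd
  exact hadd

lemma nonmeas_null [DiscreteTopology X]
    (pl : Measure (X × W d)) [IsProbabilityMeasure pl]
    (J : X × W d → ℝ) (hJmeas : Measurable J)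
    (hCoV : ∀ w : X × W d → ℝ, Continuous w →
      ∫ p, ∑ x : X, ∑ a : Fin d,
          J (x, cons a p.2) * w (x, cons a p.2) ∂pl = ∫ p, w p ∂pl)
    (x : X) (hx : ¬ MeasurableSet ({x} : Set X)) :
    pl (measurableAtom x ×ˢ (Set.univ : Set (W d))) = 0 := by
  classical
  have hAm : MeasurableSet (measurableAtom x) := MeasurableSet.measurableAtom_of_countable x
  obtain ⟨x', hx'A, hx'⟩ : ∃ x' ∈ measurableAtom x, x' ≠ x := by
    by_contra! h
    apply hx
    have : measurableAtom x = {x} :=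
      Set.Subset.antisymm (fun z hz => h z hz) (by simp)
    rwa [this] at hAm
  by_contra hne
  have hc1 : ∀ B : Set X, Continuous (fun p : X × W d => B.indicator (fun _ => (1 : ℝ)) p.1) :=
    fun B => (continuous_of_discreteTopology (f := B.indicator (fun _ => (1 : ℝ)))).comp
      continuous_fst
  have hnm : ¬ AEStronglyMeasurable
      (fun p : X × W d => ({x} : Set X).indicator (fun _ => (1 : ℝ)) p.1) pl := by
    intro hm
    obtain ⟨g, hg, hfg⟩ := hm.aemeasurable
    rw [Filter.EventuallyEq, ae_iff] at hfg
    set N := toMeasurable pl {p : X × W d |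
      ¬ ({x} : Set X).indicator (fun _ => (1 : ℝ)) p.1 = g p} with hN
    have hNm : MeasurableSet N := measurableSet_toMeasurable _ _
    have hN0 : pl N = 0 := by rw [hN, measure_toMeasurable]; exact hfg
    apply hne
    refine measure_mono_null ?_ hN0
    rintro ⟨z, y⟩ ⟨hz, -⟩
    have hsec : MeasurableSet {z : X | (z, y) ∈ N} := measurable_prodMk_right hNm
    have hex : ∃ x0 ∈ measurableAtom x, (x0, y) ∈ N := by
      by_cases h1 : g (x, y) = 1
      · refine ⟨x', hx'A, subset_toMeasurable _ _ ?_⟩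
        have := atom_const hg hx'A y
        simp [this, h1, hx']
      · refine ⟨x, mem_measurableAtom_self x, subset_toMeasurable _ _ ?_⟩
        simpa using fun h => h1 h.symm
    obtain ⟨x0, hx0, hx0N⟩ := hex
    have hz' : z ∈ measurableAtom x0 := by
      rw [measurableAtom_eq_of_mem hx0]; exact hz
    exact mem_of_mem_measurableAtom hz' hsec hx0N
  have h1 := hCoV _ (hc1 {x})
  rw [integral_undef (fun h => hnm h.aestronglyMeasurable)] at h1
  have h2 := hCoV _ (hc1 (measurableAtom x))
  have h3 : ∀ p : X × W d, ∑ z : X, ∑ a : Fin d, J (z, cons a p.2) *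
      (measurableAtom x).indicator (fun _ => (1 : ℝ)) z =
      (∑ z : X, (measurableAtom x).indicator (fun _ => (1 : ℝ)) z) *
      ∑ z : X, ∑ a : Fin d, J (z, cons a p.2) * ({x} : Set X).indicator (fun _ => (1 : ℝ)) z := by
    intro p
    have : ∑ z : X, ∑ a : Fin d, J (z, cons a p.2) * ({x} : Set X).indicator (fun _ => (1 : ℝ)) z
        = ∑ a : Fin d, J (x, cons a p.2) := by
      rw [Finset.sum_eq_single x]
      · simp
      · intro b _ hb; simp [hb]
      · simp
    rw [this, Finset.sum_mul]
    refine Finset.sum_congr rfl fun z _ => ?_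
    by_cases hz : z ∈ measurableAtom x
    · simp [hz, atom_const hJmeas hz]
    · simp [hz]
  simp only [h3] at h2
  rw [integral_const_mul, h1, mul_zero] at h2
  have h4 : (fun p : X × W d => (measurableAtom x).indicator (fun _ => (1 : ℝ)) p.1) =
      (measurableAtom x ×ˢ (Set.univ : Set (W d))).indicator (fun _ => (1 : ℝ)) := by
    funext p
    by_cases hp : p.1 ∈ measurableAtom x
    · rw [Set.indicator_of_mem hp, Set.indicator_of_mem (Set.mem_prod.2 ⟨hp, Set.mem_univ _⟩)]
    · rw [Set.indicator_of_notMem hp, Set.indicator_of_notMem (fun h => hp h.1)]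
  rw [h4, integral_indicator (hAm.prod MeasurableSet.univ)] at h2
  simp only [integral_const, smul_eq_mul, mul_one, measureReal_restrict_apply MeasurableSet.univ,
    Set.univ_inter] at h2
  apply hne
  exact (measureReal_eq_zero_iff).1 h2.symm

lemma gibbs_core [DiscreteTopology X]
    (c : X × W d → ℝ) (hcc : Continuous c) (hnorm : IsNormalized c)
    (pl : Measure (X × W d)) [IsProbabilityMeasure pl]
    (J : X × W d → ℝ) (hJmeas : Measurable J)
    (hJpos : ∀ᵐ p ∂pl, 0 < J p)
    (hJsum : ∀ᵐ p ∂pl, ∑ x : X, ∑ a : Fin d, J (x, cons a p.2) = 1)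
    (hCoV : ∀ w : X × W d → ℝ, Continuous w →
      ∫ p, ∑ x : X, ∑ a : Fin d,
          J (x, cons a p.2) * w (x, cons a p.2) ∂pl = ∫ p, w p ∂pl)
    (hInt : Integrable (fun p => Real.log (J p)) pl)
    (hEq : ∫ p, c p ∂pl + (-∫ p, Real.log (J p) ∂pl) = 0) :
    (∀ᵐ p ∂pl, ∀ x a, J (x, cons a p.2) = Real.exp (c (x, cons a p.2))) ∧
      ∀ x : X, MeasurableSet ({x} : Set X) := by
  classical
  have hJi := branch_integrable pl J hJmeas hJsum hCoV
  obtain ⟨hnn, hpl⟩ := branch_measure pl J hJmeas hJpos hJi hCoV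
  let D : X × W d → ℝ := fun p => if MeasurableSet ({p.1} : Set X) then Real.exp (c p) else 0
  have hD0 : ∀ p, 0 ≤ D p := by
    intro p; simp only [D]; split_ifs
    · exact (Real.exp_pos _).le
    · exact le_rfl
  have hDle : ∀ p, D p ≤ Real.exp (c p) := by
    intro p; simp only [D]; split_ifs
    · exact le_rfl
    · exact (Real.exp_pos _).le
  have hDm : Measurable D := by
    have : D = fun p => ∑ x : X, ({x} : Set X).indicator
        (fun _ => if MeasurableSet ({x} : Set X) then Real.exp (c (x, p.2)) else 0) p.1 := by
      funext p
      rw [Finset.sum_eq_single p.1]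
      · simp [D]
      · intro b _ hb
        rw [Set.indicator_of_notMem]
        simpa using hb.symm
      · simp
    rw [this]
    refine Finset.measurable_fun_sum _ fun x _ => ?_
    by_cases hx : MeasurableSet ({x} : Set X)
    · have hcx : Measurable (fun p : X × W d => Real.exp (c (x, p.2))) := by
        have : Continuous (fun y : W d => Real.exp (c (x, y))) :=
          Real.continuous_exp.comp (hcc.comp (by fun_prop))
        exact this.measurable.comp measurable_snd
      have := hcx.indicator (measurable_fst hx : MeasurableSet (Prod.fst ⁻¹' {x}))
      convert this using 1
      funext p
      by_cases hp : p.1 = x <;> simp [Set.indicator, hp, hx]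
    · simp [hx]
  have hS : ∀ᵐ p ∂pl, MeasurableSet ({p.1} : Set X) := by
    rw [ae_iff]
    refine measure_mono_null (t := ⋃ x ∈ {x : X | ¬ MeasurableSet ({x} : Set X)},
      measurableAtom x ×ˢ (Set.univ : Set (W d))) ?_ ?_
    · intro p hp
      simp only [Set.mem_iUnion]
      exact ⟨p.1, hp, mem_measurableAtom_self _, trivial⟩
    · rw [measure_biUnion_null_iff (Set.to_countable _)]
      intro x hx
      exact nonmeas_null pl J hJmeas hCoV x hx
  have hDc : ∀ᵐ p ∂pl, D p = Real.exp (c p) := by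
    filter_upwards [hS] with p hp
    simp [D, hp]
  -- `c` is integrable
  have hci : Integrable c pl := by
    obtain ⟨B, hB⟩ := isCompact_univ.exists_bound_of_continuousOn hcc.continuousOn
    refine Integrable.of_bound (C := B) ?_ (Eventually.of_forall fun p => hB p trivial)
    refine (Real.measurable_log.comp hDm).aestronglyMeasurable.congr ?_
    filter_upwards [hDc] with p hp
    simp [hp]
  have hlin : ∫⁻ p, ENNReal.ofReal (D p / J p) ∂pl ≤ 1 := by
    calc ∫⁻ p, ENNReal.ofReal (D p / J p) ∂pl
        = ∫⁻ p, ENNReal.ofReal (D p / J p) ∂(Mm pl (fun p => ENNReal.ofReal (J p))) := by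
          rw [← hpl]
      _ = ∫⁻ p, ∑ x : X, ∑ a : Fin d, ENNReal.ofReal (J (x, cons a p.2)) *
            ENNReal.ofReal (D (x, cons a p.2) / J (x, cons a p.2)) ∂pl :=
          lintegral_Mm pl hJmeas.ennreal_ofReal (hDm.div hJmeas).ennreal_ofReal
      _ ≤ ∫⁻ p, 1 ∂pl := by
          refine lintegral_mono fun p => ?_
          calc _ ≤ ∑ x : X, ∑ a : Fin d, ENNReal.ofReal (Real.exp (c (x, cons a p.2))) := by
                gcongr with x _ a _
                rcases le_or_gt (J (x, cons a p.2)) 0 with h | h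
                · rw [ENNReal.ofReal_of_nonpos h]; simp
                · rw [← ENNReal.ofReal_mul h.le, mul_div_cancel₀ _ h.ne']
                  exact ENNReal.ofReal_le_ofReal (hDle _)
            _ = 1 := by
                have := hnorm p.2
                simp_rw [← ENNReal.ofReal_sum_of_nonneg
                  (fun (a : Fin d) (_ : a ∈ Finset.univ) => (Real.exp_pos _).le)]
                rw [← ENNReal.ofReal_sum_of_nonneg
                  (fun x _ => Finset.sum_nonneg fun a _ => (Real.exp_pos _).le), this]
                simp
      _ = 1 := by simp
  have hrm : Measurable (fun p => D p / J p) := hDm.div hJmeas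
  have hr0 : 0 ≤ᵐ[pl] fun p => D p / J p := by
    filter_upwards [hJpos] with p hp
    exact div_nonneg (hD0 p) hp.le
  have hri : Integrable (fun p => D p / J p) pl :=
    ⟨hrm.aestronglyMeasurable, by
      rw [hasFiniteIntegral_iff_ofReal hr0]
      exact hlin.trans_lt ENNReal.one_lt_top⟩
  have hr1 : ∫ p, D p / J p ∂pl ≤ 1 := by
    rw [integral_eq_lintegral_of_nonneg_ae hr0 hrm.aestronglyMeasurable]
    exact ENNReal.toReal_le_of_le_ofReal zero_le_one (by simpa using hlin)
  have hh0 : 0 ≤ᵐ[pl] fun p => (D p / J p - 1) - (c p - Real.log (J p)) := by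
    filter_upwards [hJpos, hDc] with p hp hd
    have h1 : 0 < D p / J p := by rw [hd]; positivity
    have h2 := Real.log_le_sub_one_of_pos h1
    rw [Real.log_div (by rw [hd]; positivity) hp.ne', hd, Real.log_exp] at h2
    simp only [Pi.zero_apply]
    rw [hd]
    linarith
  have hhi : Integrable (fun p => (D p / J p - 1) - (c p - Real.log (J p))) pl :=
    (hri.sub (integrable_const 1)).sub (hci.sub hInt)
  have hhint : ∫ p, ((D p / J p - 1) - (c p - Real.log (J p))) ∂pl = 0 := by
    apply le_antisymm _ (integral_nonneg_of_ae hh0)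
    have i1 : Integrable (fun p => D p / J p - 1) pl := hri.sub (integrable_const 1)
    have i2 : Integrable (fun p => c p - Real.log (J p)) pl := hci.sub hInt
    rw [integral_sub i1 i2,
      integral_sub hri (integrable_const 1), integral_sub hci hInt]
    simp only [integral_const, probReal_univ, smul_eq_mul, mul_one]
    linarith
  have hDJ : ∀ᵐ p ∂pl, D p = J p := by
    filter_upwards [(integral_eq_zero_iff_of_nonneg_ae hh0 hhi).1 hhint, hJpos, hDc] with p h0 hp hd
    have h1 : 0 < D p / J p := by rw [hd]; positivity
    by_contra hne
    have h2 := Real.log_lt_sub_one_of_pos h1 (fun h => hne ((div_eq_one_iff_eq hp.ne').1 h))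
    rw [Real.log_div (by rw [hd]; positivity) hp.ne', hd, Real.log_exp] at h2
    simp only [Pi.zero_apply] at h0
    rw [hd] at h0
    linarith
  -- transfer to branches
  have hbr : ∀ᵐ p ∂pl, ∀ x a, J (x, cons a p.2) ≤ D (x, cons a p.2) := by
    have hE : MeasurableSet {p | D p = J p}ᶜ := (measurableSet_eq_fun hDm hJmeas).compl
    have h0 : pl {p | D p = J p}ᶜ = 0 := ae_iff.1 hDJ
    rw [hpl, Mm_apply pl hJmeas.ennreal_ofReal hE, lintegral_eq_zero_iff] at h0
    · filter_upwards [h0] with p hp x a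
      simp only [Pi.zero_apply, Finset.sum_eq_zero_iff, Finset.mem_univ, true_imp_iff] at hp
      have := hp x a
      by_contra hlt
      push Not at hlt
      rw [Set.indicator_of_mem (by exact hlt.ne)] at this
      simp only [Pi.one_apply, mul_one, ENNReal.ofReal_eq_zero] at this
      linarith [hD0 (x, cons a p.2)]
    · exact Finset.measurable_fun_sum _ fun x _ => Finset.measurable_fun_sum _ fun a _ =>
        (hJmeas.ennreal_ofReal.mul (measurable_one.indicator hE)).comp (measurable_branch x a)
  have hfinal : ∀ᵐ p ∂pl, ∀ x a, J (x, cons a p.2) = D (x, cons a p.2) ∧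
      D (x, cons a p.2) = Real.exp (c (x, cons a p.2)) := by
    filter_upwards [hbr, hJsum] with p hp hs x a
    have hle : ∀ x a, J (x, cons a p.2) ≤ Real.exp (c (x, cons a p.2)) := fun x a =>
      (hp x a).trans (hDle _)
    have h1 : ∑ x : X, ∑ a : Fin d, J (x, cons a p.2) =
        ∑ x : X, ∑ a : Fin d, Real.exp (c (x, cons a p.2)) := by rw [hs, hnorm p.2]
    have h2 := (Finset.sum_eq_sum_iff_of_le
      (fun x _ => Finset.sum_le_sum fun a _ => hle x a)).1 h1 x (Finset.mem_univ _)
    have h3 := (Finset.sum_eq_sum_iff_of_le (fun a _ => hle x a)).1 h2 a (Finset.mem_univ _)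
    constructor
    · exact le_antisymm (hp x a) (by rw [h3]; exact hDle _)
    · exact le_antisymm (hDle _) (by rw [← h3]; exact hp x a)
  constructor
  · filter_upwards [hfinal] with p hp x a
    exact (hp x a).1.trans (hp x a).2
  · intro x
    obtain ⟨p, hp⟩ := hfinal.exists
    have := (hp x (p.2 0)).2
    by_contra hx
    simp only [D, hx, if_false] at this
    exact absurd this (Real.exp_pos _).ne

lemma gibbs_unique [Nonempty X] [DiscreteTopology X]
    (c : X × W d → ℝ) (K : ℝ) (hK : 0 ≤ K) (hvar : ∀ x, VarBd K (fun y => c (x, y)))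
    (hnorm : IsNormalized c) (hcc : Continuous c)
    (μ ν : Measure (X × W d)) [IsProbabilityMeasure μ] [IsProbabilityMeasure ν]
    (hμ : GibbsFixed c μ) (hν : GibbsFixed c ν) : μ = ν := by
  classical
  have hle1 : ∀ p, Real.exp (c p) ≤ 1 := by
    intro ⟨x, y⟩
    rw [← hnorm (shift y)]
    calc Real.exp (c (x, y)) = Real.exp (c (x, cons (y 0) (shift y))) := by rw [cons_shift]
      _ ≤ ∑ a : Fin d, Real.exp (c (x, cons a (shift y))) :=
          Finset.single_le_sum (f := fun a => Real.exp (c (x, cons a (shift y))))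
            (fun a _ => (Real.exp_pos _).le) (Finset.mem_univ _)
      _ ≤ _ := Finset.single_le_sum (f := fun x => ∑ a : Fin d, Real.exp (c (x, cons a (shift y))))
            (fun x _ => Finset.sum_nonneg fun a _ => (Real.exp_pos _).le) (Finset.mem_univ _)
  have hexp : ∀ s t : ℝ, Real.exp s ≤ 1 → Real.exp s - Real.exp t ≤ |s - t| := by
    intro s t hs
    have h1 : t - s + 1 ≤ Real.exp (t - s) := Real.add_one_le_exp _
    have h2 : Real.exp t = Real.exp s * Real.exp (t - s) := by rw [← Real.exp_add]; ring_nf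
    have h3 := Real.exp_pos s
    have h4 : s - t ≤ |s - t| := le_abs_self _
    have h5 : 0 ≤ |s - t| := abs_nonneg _
    rw [h2]
    nlinarith [mul_le_mul_of_nonneg_left h1 h3.le]
  have hEvar : ∀ x, VarBd K (fun y => Real.exp (c (x, y))) := by
    intro x k y z hyz
    refine le_trans ?_ (hvar x k y z hyz)
    rw [abs_le]
    have h1 := hexp (c (x, y)) (c (x, z)) (hle1 _)
    have h2 := hexp (c (x, z)) (c (x, y)) (hle1 _)
    rw [abs_sub_comm] at h2
    constructor <;> linarith
  obtain ⟨B, hB⟩ := isCompact_univ.exists_bound_of_continuousOn hcc.continuousOn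
  have hE : ∀ p, Real.exp (-B) ≤ Real.exp (c p) := by
    intro p
    have := hB p trivial
    rw [Real.norm_eq_abs] at this
    exact Real.exp_le_exp.2 (abs_le.1 this).1
  have hpos : ∀ p, 0 ≤ Real.exp (c p) := fun p => (Real.exp_pos _).le
  have hmarg := unique_marg (E := fun p => Real.exp (c p)) (Real.exp_pos (-B)) hE hnorm hEvar hK μ ν
    (fun v hv => hμ (fun p => v p.2) (hv.comp continuous_snd))
    (fun v hv => hν (fun p => v p.2) (hv.comp continuous_snd))
  apply ext_rect
  intro A hA C hC
  have hS : MeasurableSet (A ×ˢ C) := hA.prod (MeasurableSet.of_mem_measurableCylinders hC)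
  obtain ⟨R, hR⟩ := cyl_var hC
  set u := (A ×ˢ C).indicator (fun _ => (1 : ℝ)) with hu
  have hu1 : ∀ p, |u p| ≤ 1 := by
    intro p
    simp only [hu, Set.indicator]
    split_ifs <;> simp
  have huvar : ∀ x, VarBd R (fun y => u (x, y)) := by
    intro x k y z hyz
    have h1 := hR k y z hyz
    by_cases hx : x ∈ A
    · have : ∀ y, u (x, y) = C.indicator (fun _ => (1 : ℝ)) y := by
        intro y
        by_cases hy : y ∈ C <;> simp [hu, hx, hy]
      simpa only [this] using h1
    · have : ∀ y, u (x, y) = 0 := by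
        intro y
        simp [hu, hx]
      simp only [this, sub_self, abs_zero]
      exact (abs_nonneg _).trans h1
  have hLvar := Lop_var_aux hpos hnorm hEvar hK (B := 1)
    (R := max R (Fintype.card X * d * (K * 1))) hu1 (fun x => (huvar x).mono (le_max_left _ _))
    (le_max_right _ _)
  have hLb : ∀ y : W d, |∑ x : X, ∑ a : Fin d, Real.exp (c (x, cons a y)) * u (x, cons a y)| ≤ 1 := by
    intro y
    rw [← hnorm y]
    refine (Finset.abs_sum_le_sum_abs _ _).trans (Finset.sum_le_sum fun x _ => ?_)
    refine (Finset.abs_sum_le_sum_abs _ _).trans (Finset.sum_le_sum fun a _ => ?_)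
    rw [abs_mul, abs_of_nonneg (hpos _)]
    exact mul_le_of_le_one_right (hpos _) (hu1 _)
  have heq := hmarg _ 1 _ hLb hLvar
  have e1 := hμ u (rect_continuous A hC)
  have e2 := hν u (rect_continuous A hC)
  have e3 : ∫ p, u p ∂μ = ∫ p, u p ∂ν := by rw [e1, e2]; exact heq
  rw [hu, integral_indicator hS, integral_indicator hS] at e3
  simp only [integral_const, smul_eq_mul, mul_one, measureReal_restrict_apply MeasurableSet.univ,
    Set.univ_inter] at e3
  exact (measureReal_eq_measureReal_iff).1 e3

/-- If `c` is a normalized cost (hence `P(c) = 0`) and `pl ∈ Π(·,σ)` satisfies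
`∫ c dpl + H(pl) = 0` (with `H(pl) = −∫ log J_pl dpl`), then `pl` is the unique Gibbs
plan for `c`, i.e. `L̂_c^* pl = pl`, and any Gibbs plan for `c` equals `pl`. -/
theorem equilibrium_plan_is_gibbs
    [Nonempty X] [DiscreteTopology X]
    (c : X × W d → ℝ) (hc : LipCost c) (hnorm : IsNormalized c)
    (pl : Measure (X × W d)) (hpl : IsPlan pl)
    (J : X × W d → ℝ) (hJmeas : Measurable J)
    (hJpos : ∀ᵐ p ∂pl, 0 < J p)
    (hJsum : ∀ᵐ p ∂pl, ∑ x : X, ∑ a : Fin d, J (x, cons a p.2) = 1)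
    (hCoV : ∀ w : X × W d → ℝ, Continuous w →
      ∫ p, ∑ x : X, ∑ a : Fin d,
          J (x, cons a p.2) * w (x, cons a p.2) ∂pl = ∫ p, w p ∂pl)
    (hInt : Integrable (fun p => Real.log (J p)) pl)
    (hEq : ∫ p, c p ∂pl + (-∫ p, Real.log (J p) ∂pl) = 0) :
    GibbsFixed c pl ∧
      ∀ pl' : Measure (X × W d), IsProbabilityMeasure pl' →
        GibbsFixed c pl' → pl' = pl := by
  obtain ⟨hprob, -⟩ := hpl
  obtain ⟨K, hK⟩ := hc
  have hvar : ∀ x, VarBd |K| (fun y => c (x, y)) := by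
    intro x k y z hyz
    have h1 : dist y z ≤ (1 / 2) ^ k := PiNat.mem_cylinder_iff_dist_le.1 hyz
    have h0 : 0 ≤ dist y z := PiNat.dist_nonneg y z
    calc |c (x, y) - c (x, z)| ≤ K * dist y z := hK x y z
      _ ≤ |K| * dist y z := mul_le_mul_of_nonneg_right (le_abs_self K) h0
      _ ≤ |K| * (1 / 2) ^ k := mul_le_mul_of_nonneg_left h1 (abs_nonneg K)
  have hcc : Continuous c := by
    rw [continuous_prod_of_discrete_left]
    exact fun x => (hvar x).continuous
  obtain ⟨hJc, -⟩ := gibbs_core c hcc hnorm pl J hJmeas hJpos hJsum hCoV hInt hEq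
  have hG : GibbsFixed c pl := by
    intro u hu
    rw [← hCoV u hu]
    apply integral_congr_ae
    filter_upwards [hJc] with p hp
    simp only [hp]
  refine ⟨hG, ?_⟩
  intro pl' _ hG'
  exact gibbs_unique c |K| (abs_nonneg K) hvar hnorm hcc pl' pl hG' hG
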